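/- Let W : X → P(Y) with X, Y finite, α ∈ (0,1], C a nonempty convex set of probability mass functions on X with C_α(W,C) := sup_{P∈C} inf_Q Σ_x P(x) D_α(W(x)‖Q) < ∞, and let Q_C be a probability mass function achieving inf_Q sup_{P∈C} Σ_x P(x) D_α(W(x)‖Q). Then for every probability mass function Q on Y: sup_{P∈C} Σ_x P(x) D_α(W(x)‖Q) ≥ C_α(W,C) + D_α(Q_C‖Q) (Erven–Harremoës bound for the Augustin capacity). -/

import Mathlib

open scoped BigOperators

/-- A probability mass function on a finite type. -/
def IsPMF {Y : Type*} [Fintype Y] (Q : Y → ℝ) : Prop :=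
  (∀ y, 0 ≤ Q y) ∧ ∑ y, Q y = 1

/-- The power sum appearing in the Rényi divergence; since `(0:ℝ) ^ (1-α) = 0` for `1-α > 0`,
the sum automatically restricts to `y` with `Q y > 0`. -/
noncomputable def rSum {Y : Type*} [Fintype Y] (α : ℝ) (W Q : Y → ℝ) : ℝ :=
  ∑ y, W y ^ α * Q y ^ (1 - α)

/-- Order-`α` Rényi divergence (for `α ∈ (0,1)`), valued in `EReal`, with the convention
that it is `⊤` when the power sum vanishes. -/
noncomputable def rDiv {Y : Type*} [Fintype Y] (α : ℝ) (W Q : Y → ℝ) : EReal :=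
  if rSum α W Q = 0 then ⊤
  else (((1 / (α - 1)) * Real.log (rSum α W Q) : ℝ) : EReal)

/-- Kullback–Leibler divergence, valued in `EReal`, `⊤` unless `W ≪ Q`. -/
noncomputable def kDiv {Y : Type*} [Fintype Y] (W Q : Y → ℝ) : EReal :=
  if ∀ y, Q y = 0 → W y = 0 then
    (((∑ y, if W y = 0 then 0 else W y * Real.log (W y / Q y)) : ℝ) : EReal)
  else ⊤

/-- Order-`α` divergence for `α ∈ (0,1]`: Rényi for `α ≠ 1`, KL for `α = 1`. -/
noncomputable def dA {Y : Type*} [Fintype Y] (α : ℝ) (W Q : Y → ℝ) : EReal :=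
  if α = 1 then kDiv W Q else rDiv α W Q

/-- Conditional divergence `D_α(W‖Q|P) = ∑_x P(x) D_α(W(x)‖Q)`. -/
noncomputable def cDiv {X Y : Type*} [Fintype X] [Fintype Y]
    (α : ℝ) (W : X → Y → ℝ) (Q : Y → ℝ) (P : X → ℝ) : EReal :=
  ∑ x, (P x : EReal) * dA α (W x) Q

/-- Augustin information `I_α(P;W) = inf_Q D_α(W‖Q|P)`. -/
noncomputable def aInfo {X Y : Type*} [Fintype X] [Fintype Y]
    (α : ℝ) (P : X → ℝ) (W : X → Y → ℝ) : EReal :=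
  ⨅ Q ∈ {Q : Y → ℝ | IsPMF Q}, cDiv α W Q P

open Filter Topology

lemma dA_ne_bot {Y : Type*} [Fintype Y] (α : ℝ) (W Q : Y → ℝ) : dA α W Q ≠ ⊥ := by
  unfold dA kDiv rDiv
  split_ifs <;> first | exact EReal.coe_ne_bot _ | exact top_ne_bot

lemma cDiv_real {X Y : Type*} [Fintype X] [Fintype Y] (α : ℝ) (W : X → Y → ℝ) (Q : Y → ℝ)
    (P : X → ℝ) (h : ∀ x, P x ≠ 0 → dA α (W x) Q ≠ ⊤) :
    cDiv α W Q P = ((∑ x, P x * (dA α (W x) Q).toReal : ℝ) : EReal) := by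
  unfold cDiv
  have : ∀ x, (P x : EReal) * dA α (W x) Q = ((P x * (dA α (W x) Q).toReal : ℝ) : EReal) := by
    intro x
    by_cases hx : P x = 0
    · simp [hx]
    · rw [EReal.coe_mul, EReal.coe_toReal (h x hx) (dA_ne_bot _ _ _)]
  simp_rw [this]
  exact (map_sum (⟨⟨Real.toEReal, rfl⟩, EReal.coe_add⟩ : ℝ →+ EReal) _ _).symm

lemma sum_ne_bot {X : Type*} (s : Finset X) (f : X → EReal) (h : ∀ x, f x ≠ ⊥) :
    ∑ x ∈ s, f x ≠ ⊥ := by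
  classical
  induction s using Finset.induction_on with
  | empty => simp
  | insert a s ha ih => rw [Finset.sum_insert ha]; simp [EReal.add_eq_bot_iff, h a, ih]

lemma term_ne_bot {p : ℝ} (hp : 0 ≤ p) {d : EReal} (hd : d ≠ ⊥) : (p : EReal) * d ≠ ⊥ := by
  induction d using EReal.rec with
  | bot => exact absurd rfl hd
  | coe d => rw [← EReal.coe_mul]; exact EReal.coe_ne_bot _
  | top =>
    rcases hp.eq_or_lt with h | h
    · simp [← h]
    · rw [EReal.coe_mul_top_of_pos h]; simp

lemma cDiv_top {X Y : Type*} [Fintype X] [Fintype Y] (α : ℝ) (W : X → Y → ℝ) (Q : Y → ℝ)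
    (P : X → ℝ) (hP : ∀ x, 0 ≤ P x) (x : X) (hx : P x ≠ 0) (h : dA α (W x) Q = ⊤) :
    cDiv α W Q P = ⊤ := by
  classical
  unfold cDiv
  rw [← Finset.add_sum_erase _ _ (Finset.mem_univ x), h,
    EReal.coe_mul_top_of_pos (lt_of_le_of_ne (hP x) (Ne.symm hx))]
  exact EReal.top_add_of_ne_bot (sum_ne_bot _ _ fun z => term_ne_bot (hP z) (dA_ne_bot _ _ _))

/-- Abstract first-order optimality plus projection argument. -/
theorem core {X Y : Type*} [Fintype X] [Fintype Y] (K : Set (X → ℝ)) (hK : IsCompact K)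
    (hKc : Convex ℝ K) (hKne : K.Nonempty) (A : Set X) (hA : ∀ P ∈ K, ∀ x, x ∉ A → P x = 0)
    (hKs : ∀ P ∈ K, ∑ x, P x = 1)
    (a : X → ℝ) (V : ℝ) (hV : ∀ P ∈ K, ∑ x, P x * a x ≤ V)
    (T : X → Y → ℝ) (β : X → ℝ) (QC : Y → ℝ) (hQ0 : ∀ y, 0 ≤ QC y) (hQ1 : ∑ y, QC y = 1)
    (hT1 : ∀ x ∈ A, ∑ y, T x y = 1) (hT0 : ∀ x ∈ A, ∀ y, QC y = 0 → T x y = 0)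
    (hpath : ∀ P0 ∈ K, ∃ G : ℝ → X → ℝ, (∀ x ∈ A, G 0 x = a x) ∧
      (∀ᶠ t in 𝓝[>] (0:ℝ), ∃ P ∈ K, V ≤ ∑ x, P x * G t x) ∧
      ∀ x ∈ A, HasDerivWithinAt (fun t => G t x)
        (1 - ∑ y, T x y * (∑ z, P0 z * T z y) / QC y - β x * ∑ z, P0 z * β z) (Set.Ioi 0) 0) :
    ∃ P ∈ K, V ≤ ∑ x, P x * a x ∧ (∀ y, ∑ x, P x * T x y = QC y) ∧ ∑ x, P x * β x = 0 := by
  have step1 : ∀ P0 ∈ K, ∃ P ∈ K, V ≤ ∑ x, P x * a x ∧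
      0 ≤ ∑ x, P x * (1 - ∑ y, T x y * (∑ z, P0 z * T z y) / QC y - β x * ∑ z, P0 z * β z) := by
    intro P0 hP0
    obtain ⟨G, hG0, hGe, hGd⟩ := hpath P0 hP0
    set δ : X → ℝ := fun x =>
      (1 - ∑ y, T x y * (∑ z, P0 z * T z y) / QC y - β x * ∑ z, P0 z * β z) with hδ
    have hex : ∃ t : ℕ → ℝ, Tendsto t atTop (𝓝[>] 0) := exists_seq_tendsto _
    obtain ⟨t, ht⟩ := hex
    have hev := ht.eventually (hGe.and self_mem_nhdsWithin)
    obtain ⟨N, hN⟩ := eventually_atTop.1 hev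
    have hN' : ∀ n, ∃ P ∈ K, V ≤ ∑ x, P x * G (t (n + N)) x := fun n => (hN _ (by omega)).1
    have hpos : ∀ n, 0 < t (n + N) := fun n => (hN _ (by omega)).2
    choose p hpK hpV using hN'
    obtain ⟨P, hPK, φ, hφ, hlim⟩ := hK.tendsto_subseq hpK
    have hx : ∀ x, Tendsto (fun n => p (φ n) x) atTop (𝓝 (P x)) := fun x =>
      (tendsto_pi_nhds.1 hlim) x
    have ht' : Tendsto (fun n => t (φ n + N)) atTop (𝓝[>] 0) :=
      ht.comp ((tendsto_add_atTop_nat N).comp hφ.tendsto_atTop)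
    have hslope : ∀ x ∈ A, Tendsto (fun n => slope (fun t => G t x) 0 (t (φ n + N))) atTop
        (𝓝 (δ x)) := by
      intro x hxA
      have := (hasDerivWithinAt_iff_tendsto_slope' (by simp)).1 (hGd x hxA)
      exact this.comp ht'
    have hGlim : ∀ x ∈ A, Tendsto (fun n => G (t (φ n + N)) x) atTop (𝓝 (a x)) := by
      intro x hxA
      have := (hGd x hxA).continuousWithinAt.tendsto.comp ht'
      rw [hG0 x hxA] at this
      exact this
    refine ⟨P, hPK, ?_, ?_⟩
    · refine ge_of_tendsto' (b := V) (x := atTop)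
        (f := fun n => ∑ x, p (φ n) x * G (t (φ n + N)) x) ?_ (fun n => hpV _)
      refine tendsto_finsetSum _ fun x _ => ?_
      by_cases hxA : x ∈ A
      · exact (hx x).mul (hGlim x hxA)
      · simp [hA _ (hpK _) x hxA, hA _ hPK x hxA]
    · refine ge_of_tendsto' (x := atTop)
        (f := fun n => ∑ x, p (φ n) x * slope (fun t => G t x) 0 (t (φ n + N))) ?_ ?_
      · refine tendsto_finsetSum _ fun x _ => ?_
        by_cases hxA : x ∈ A
        · exact (hx x).mul (hslope x hxA)
        · simp [hA _ (hpK _) x hxA, hA _ hPK x hxA]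
      · intro n
        have e : ∑ x, p (φ n) x * slope (fun t => G t x) 0 (t (φ n + N)) =
            (t (φ n + N))⁻¹ * (∑ x, p (φ n) x * G (t (φ n + N)) x - ∑ x, p (φ n) x * a x) := by
          rw [← Finset.sum_sub_distrib, Finset.mul_sum]
          refine Finset.sum_congr rfl fun x _ => ?_
          by_cases hxA : x ∈ A
          · simp only [slope, hG0 x hxA, vsub_eq_sub, smul_eq_mul, sub_zero]; ring
          · simp [hA _ (hpK _) x hxA]
        rw [e]
        have h1 := hpV (φ n)
        have h2 := hV _ (hpK (φ n))
        have h3 := hpos (φ n)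
        exact mul_nonneg (inv_nonneg.2 h3.le) (by linarith)
  let K' : Set (X → ℝ) := K ∩ {P | V ≤ ∑ x, P x * a x}
  have hK' : IsCompact K' := hK.inter_right (isClosed_le continuous_const (by fun_prop))
  have hK'ne : K'.Nonempty := by
    obtain ⟨P0, h0⟩ := hKne
    obtain ⟨P, h, h', _⟩ := step1 P0 h0
    exact ⟨P, h, h'⟩
  let B : (X → ℝ) → (X → ℝ) → ℝ := fun P P' =>
    ∑ y, (∑ x, P x * T x y) * (∑ x, P' x * T x y) / QC y + (∑ x, P x * β x) * (∑ x, P' x * β x)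
  obtain ⟨P0, hP0, hmin⟩ := hK'.exists_isMinOn hK'ne
    (f := fun P => B P P) (by
      have : Continuous (fun P => B P P) := by
        simp only [B, div_eq_mul_inv]
        fun_prop
      exact this.continuousOn)
  obtain ⟨P, hPK, hPV, hPd⟩ := step1 P0 hP0.1
  have hB1 : B P P0 ≤ 1 := by
    have e : ∑ x, P x * (1 - ∑ y, T x y * (∑ z, P0 z * T z y) / QC y - β x * ∑ z, P0 z * β z)
        = 1 - B P P0 := by
      simp only [B, mul_sub, mul_one, Finset.sum_sub_distrib, hKs P hPK]
      have e1 : ∑ x, P x * ∑ y, T x y * (∑ z, P0 z * T z y) / QC y =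
          ∑ y, (∑ x, P x * T x y) * (∑ x, P0 x * T x y) / QC y := by
        simp_rw [Finset.mul_sum Finset.univ (fun y => _ / _)]
        rw [Finset.sum_comm]
        refine Finset.sum_congr rfl fun y _ => ?_
        rw [Finset.sum_mul, Finset.sum_div]
        refine Finset.sum_congr rfl fun x _ => ?_
        ring
      have e2 : ∑ x, P x * (β x * ∑ z, P0 z * β z) = (∑ x, P x * β x) * ∑ z, P0 z * β z := by
        rw [Finset.sum_mul]
        refine Finset.sum_congr rfl fun x _ => ?_
        ring
      rw [e1, e2]; ring
    linarith
  have hB2 : B P0 P0 ≤ B P P0 := by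
    by_contra hcon
    push Not at hcon
    have hs : ∀ s : ℝ, 0 < s → s ≤ 1 →
        0 ≤ 2 * (B P P0 - B P0 P0) + s * (B P P - 2 * B P P0 + B P0 P0) := by
      intro s hs0 hs1
      have hmem : (1 - s) • P0 + s • P ∈ K' := by
        refine ⟨hKc hP0.1 hPK (by linarith) hs0.le (by ring), ?_⟩
        have : ∑ x, ((1 - s) • P0 + s • P) x * a x =
            (1 - s) * ∑ x, P0 x * a x + s * ∑ x, P x * a x := by
          rw [Finset.mul_sum, Finset.mul_sum, ← Finset.sum_add_distrib]
          refine Finset.sum_congr rfl fun x _ => ?_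
          simp; ring
        have h1 : V ≤ ∑ x, P0 x * a x := hP0.2
        show V ≤ _
        rw [this]
        nlinarith
      have hm : B P0 P0 ≤ B ((1 - s) • P0 + s • P) ((1 - s) • P0 + s • P) := hmin hmem
      have lin : ∀ c : X → ℝ, ∑ x, ((1 - s) • P0 + s • P) x * c x =
            (1 - s) * ∑ x, P0 x * c x + s * ∑ x, P x * c x := by
        intro c
        rw [Finset.mul_sum, Finset.mul_sum, ← Finset.sum_add_distrib]
        refine Finset.sum_congr rfl fun x _ => ?_
        simp; ring
      have e : B ((1 - s) • P0 + s • P) ((1 - s) • P0 + s • P) =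
          (1 - s)^2 * B P0 P0 + 2 * s * (1 - s) * B P P0 + s^2 * B P P := by
        simp only [B, lin, mul_add, Finset.mul_sum Finset.univ (fun y => _ / _)]
        rw [show ∀ a b c d e f : ℝ, a + b + (c + d) + (e + f) = (a + c + e) + (b + d + f) from
          fun _ _ _ _ _ _ => by ring, ← Finset.sum_add_distrib, ← Finset.sum_add_distrib]
        congr 1
        · refine Finset.sum_congr rfl fun y _ => ?_
          ring
        · ring
      rw [e] at hm
      have : 0 ≤ s * (2 * (B P P0 - B P0 P0) + s * (B P P - 2 * B P P0 + B P0 P0)) := by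
        linarith
      exact nonneg_of_mul_nonneg_right this hs0
    have hlim : Tendsto (fun s : ℝ => 2 * (B P P0 - B P0 P0) + s * (B P P - 2 * B P P0 + B P0 P0))
        (𝓝[>] 0) (𝓝 (2 * (B P P0 - B P0 P0) + 0 * (B P P - 2 * B P P0 + B P0 P0))) := by
      apply Tendsto.mono_left _ nhdsWithin_le_nhds
      apply Continuous.tendsto
      fun_prop
    have := ge_of_tendsto hlim (b := 0) (by
      filter_upwards [Ioc_mem_nhdsGT (zero_lt_one (α := ℝ))] with s hs'
      exact hs s hs'.1 hs'.2)
    linarith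
  have hR0 : ∀ y, QC y = 0 → ∑ x, P0 x * T x y = 0 := by
    intro y hy
    refine Finset.sum_eq_zero fun x _ => ?_
    by_cases hxA : x ∈ A
    · simp [hT0 x hxA y hy]
    · simp [hA _ hP0.1 x hxA]
  have hR1 : ∑ y, ∑ x, P0 x * T x y = 1 := by
    rw [Finset.sum_comm, ← hKs P0 hP0.1]
    refine Finset.sum_congr rfl fun x _ => ?_
    rw [← Finset.mul_sum]
    by_cases hxA : x ∈ A
    · simp [hT1 x hxA]
    · simp [hA _ hP0.1 x hxA]
  have hsq : ∑ y, ((∑ x, P0 x * T x y) - QC y)^2 / QC y + (∑ x, P0 x * β x)^2 ≤ 0 := by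
    have e : ∑ y, ((∑ x, P0 x * T x y) - QC y)^2 / QC y =
        ∑ y, ((∑ x, P0 x * T x y) * (∑ x, P0 x * T x y) / QC y
          - 2 * (∑ x, P0 x * T x y) + QC y) := by
      refine Finset.sum_congr rfl fun y _ => ?_
      by_cases hy : QC y = 0
      · simp [hR0 y hy, hy]
      · field_simp; ring
    rw [e, Finset.sum_add_distrib, Finset.sum_sub_distrib, ← Finset.mul_sum, hR1, hQ1]
    have : B P0 P0 ≤ 1 := hB2.trans hB1
    simp only [B] at this
    nlinarith
  have hnn : ∀ y ∈ Finset.univ, 0 ≤ ((∑ x, P0 x * T x y) - QC y)^2 / QC y := fun y _ =>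
    div_nonneg (sq_nonneg _) (hQ0 y)
  have hs1 := Finset.sum_nonneg hnn
  have hs2 := sq_nonneg (∑ x, P0 x * β x)
  refine ⟨P0, hP0.1, hP0.2, ?_, ?_⟩
  · intro y
    have h0 : ∑ y, ((∑ x, P0 x * T x y) - QC y)^2 / QC y = 0 := by linarith
    have := (Finset.sum_eq_zero_iff_of_nonneg hnn).1 h0 y (Finset.mem_univ y)
    by_cases hy : QC y = 0
    · rw [hR0 y hy, hy]
    · rw [div_eq_zero_iff] at this
      rcases this with h | h
      · have := pow_eq_zero_iff (two_ne_zero) |>.1 h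
        linarith
      · exact absurd h hy
  · have : (∑ x, P0 x * β x)^2 = 0 := by linarith
    exact pow_eq_zero_iff (two_ne_zero) |>.1 this

lemma dA_fin_of_sup {X Y : Type*} [Fintype X] [Fintype Y] (α : ℝ) (W : X → Y → ℝ)
    (C : Set (X → ℝ)) (hCpmf : ∀ P ∈ C, IsPMF P) (Q : Y → ℝ)
    (h : (⨆ P ∈ C, cDiv α W Q P) ≠ ⊤) : ∀ x, (∃ P ∈ C, P x ≠ 0) → dA α (W x) Q ≠ ⊤ := by
  rintro x ⟨P, hP, hx⟩ ht
  apply h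
  rw [eq_top_iff, ← cDiv_top α W Q P (hCpmf P hP).1 x hx ht]
  exact le_iSup₂ (f := fun P (_ : P ∈ C) => cDiv α W Q P) P hP

lemma le_sup_closure {X Y : Type*} [Fintype X] [Fintype Y] (α : ℝ) (W : X → Y → ℝ)
    (C : Set (X → ℝ)) (hCpmf : ∀ P ∈ C, IsPMF P) (hCne : C.Nonempty) (Q : Y → ℝ)
    (h : (⨆ P ∈ C, cDiv α W Q P) ≠ ⊤) (P : X → ℝ) (hP : P ∈ closure C) :
    ((∑ x, P x * (dA α (W x) Q).toReal : ℝ) : EReal) ≤ ⨆ P ∈ C, cDiv α W Q P := by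
  have hf := dA_fin_of_sup α W C hCpmf Q h
  have hle : ∀ P ∈ C, ((∑ x, P x * (dA α (W x) Q).toReal : ℝ) : EReal)
      ≤ ⨆ P ∈ C, cDiv α W Q P := by
    intro P hP
    rw [← cDiv_real α W Q P fun x hx => hf x ⟨P, hP, hx⟩]
    exact le_iSup₂ (f := fun P (_ : P ∈ C) => cDiv α W Q P) P hP
  set F := ⨆ P ∈ C, cDiv α W Q P
  have hb : F ≠ ⊥ := by
    obtain ⟨P, hP⟩ := hCne
    intro hb
    have := hle P hP
    rw [hb, le_bot_iff] at this
    exact EReal.coe_ne_bot _ this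
  rw [← EReal.coe_toReal h hb] at hle ⊢
  simp only [EReal.coe_le_coe_iff] at hle ⊢
  have hcl : IsClosed {P : X → ℝ | ∑ x, P x * (dA α (W x) Q).toReal ≤ F.toReal} :=
    isClosed_le (by fun_prop) continuous_const
  exact closure_minimal hle hcl hP

theorem bridge {X Y : Type*} [Fintype X] [Fintype Y] (α : ℝ) (W : X → Y → ℝ)
    (C : Set (X → ℝ)) (hCne : C.Nonempty) (hCpmf : ∀ P ∈ C, IsPMF P)
    (hCconv : Convex ℝ C) (QC : Y → ℝ) (hQC : IsPMF QC)
    (hQCmin : ∀ Q : Y → ℝ, IsPMF Q →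
      (⨆ P ∈ C, cDiv α W QC P) ≤ ⨆ P ∈ C, cDiv α W Q P)
    (hfin : (⨆ P ∈ C, cDiv α W QC P) ≠ ⊤)
    (T : X → Y → ℝ) (β : X → ℝ)
    (hT : ∀ x, (∃ P ∈ C, P x ≠ 0) → IsPMF (T x))
    (hT0 : ∀ x, (∃ P ∈ C, P x ≠ 0) → ∀ y, QC y = 0 → T x y = 0)
    (hβ : ∀ x, (∃ P ∈ C, P x ≠ 0) → 0 ≤ β x)
    (hpath : ∀ R : Y → ℝ, IsPMF R → (∀ y, QC y = 0 → R y = 0) → ∀ κ : ℝ, 0 ≤ κ →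
      ∃ Qp : ℝ → Y → ℝ, Qp 0 = QC ∧ (∀ᶠ t in 𝓝[>] (0:ℝ), IsPMF (Qp t)) ∧
        ∀ x, (∃ P ∈ C, P x ≠ 0) → (∀ᶠ t in 𝓝[>] (0:ℝ), dA α (W x) (Qp t) ≠ ⊤) ∧
          HasDerivWithinAt (fun t => (dA α (W x) (Qp t)).toReal)
            (1 - ∑ y, T x y * R y / QC y - β x * κ) (Set.Ioi 0) 0) :
    ∃ P ∈ closure C, IsPMF P ∧ (∀ x, P x ≠ 0 → ∃ P ∈ C, P x ≠ 0) ∧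
      (⨆ P ∈ C, cDiv α W QC P) ≤ ((∑ x, P x * (dA α (W x) QC).toReal : ℝ) : EReal) ∧
      (∀ y, ∑ x, P x * T x y = QC y) ∧ ∑ x, P x * β x = 0 := by
  classical
  have hcl0 : ∀ P ∈ closure C, ∀ x, 0 ≤ P x := by
    intro P hP x
    have hcl : IsClosed {P : X → ℝ | 0 ≤ P x} := isClosed_le continuous_const (by fun_prop)
    exact closure_minimal (fun P hP => (hCpmf P hP).1 x) hcl hP
  have hcl1 : ∀ P ∈ closure C, ∑ x, P x = 1 := by
    intro P hP
    have hcl : IsClosed {P : X → ℝ | ∑ x, P x = 1} := isClosed_eq (by fun_prop) continuous_const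
    exact closure_minimal (fun P hP => (hCpmf P hP).2) hcl hP
  have hclA : ∀ P ∈ closure C, ∀ x, x ∉ {x | ∃ P ∈ C, P x ≠ 0} → P x = 0 := by
    intro P hP x hx
    have hcl : IsClosed {P : X → ℝ | P x = 0} := isClosed_eq (by fun_prop) continuous_const
    refine closure_minimal (fun P hP => ?_) hcl hP
    by_contra h
    exact hx ⟨P, hP, h⟩
  have hK : IsCompact (closure C) := by
    apply Bornology.IsBounded.isCompact_closure
    refine (isCompact_univ_pi (fun _ : X => isCompact_Icc (a := (0:ℝ)) (b := 1))).isBounded.subset ?_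
    intro P hP x _
    refine ⟨(hCpmf P hP).1 x, ?_⟩
    rw [← (hCpmf P hP).2]
    exact Finset.single_le_sum (fun z _ => (hCpmf P hP).1 z) (Finset.mem_univ x)
  set F := ⨆ P ∈ C, cDiv α W QC P with hF
  have hup : ∀ P ∈ closure C, ((∑ x, P x * (dA α (W x) QC).toReal : ℝ) : EReal) ≤ F :=
    fun P hP => le_sup_closure α W C hCpmf hCne QC hfin P hP
  have hb : F ≠ ⊥ := by
    obtain ⟨P, hP⟩ := hCne
    intro hb
    have := hup P (subset_closure hP)
    rw [hb, le_bot_iff] at this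
    exact EReal.coe_ne_bot _ this
  have hFr : ((F.toReal : ℝ) : EReal) = F := EReal.coe_toReal hfin hb
  obtain ⟨P, hP, h1, h2, h3⟩ := core (closure C) hK hCconv.closure hCne.closure
    {x | ∃ P ∈ C, P x ≠ 0} hclA hcl1 (fun x => (dA α (W x) QC).toReal) F.toReal
    (by
      intro P hP
      have := hup P hP
      rw [← hFr] at this
      exact EReal.coe_le_coe_iff.1 this)
    T β QC hQC.1 hQC.2 (fun x hx => (hT x hx).2) hT0
    (by
      intro P0 hP0
      obtain ⟨Qp, hq0, hq1, hq2⟩ := hpath (fun y => ∑ z, P0 z * T z y) (by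
          constructor
          · intro y
            refine Finset.sum_nonneg fun x _ => ?_
            by_cases hx : ∃ P ∈ C, P x ≠ 0
            · exact mul_nonneg (hcl0 P0 hP0 x) ((hT x hx).1 y)
            · simp [hclA P0 hP0 x hx]
          · rw [Finset.sum_comm, ← hcl1 P0 hP0]
            refine Finset.sum_congr rfl fun x _ => ?_
            rw [← Finset.mul_sum]
            by_cases hx : ∃ P ∈ C, P x ≠ 0
            · rw [(hT x hx).2, mul_one]
            · simp [hclA P0 hP0 x hx])
        (by
          intro y hy
          refine Finset.sum_eq_zero fun x _ => ?_
          by_cases hx : ∃ P ∈ C, P x ≠ 0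
          · simp [hT0 x hx y hy]
          · simp [hclA P0 hP0 x hx])
        (∑ z, P0 z * β z) (by
          refine Finset.sum_nonneg fun x _ => ?_
          by_cases hx : ∃ P ∈ C, P x ≠ 0
          · exact mul_nonneg (hcl0 P0 hP0 x) (hβ x hx)
          · simp [hclA P0 hP0 x hx])
      refine ⟨fun t x => (dA α (W x) (Qp t)).toReal, ?_, ?_, fun x hx => (hq2 x hx).2⟩
      · intro x _
        simp only [hq0]
      · have hall : ∀ᶠ t in 𝓝[>] (0:ℝ), ∀ x, (∃ P ∈ C, P x ≠ 0) → dA α (W x) (Qp t) ≠ ⊤ := by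
          rw [eventually_all]
          intro x
          by_cases hx : ∃ P ∈ C, P x ≠ 0
          · filter_upwards [(hq2 x hx).1] with t ht _ using ht
          · filter_upwards with t h using absurd h hx
        filter_upwards [hq1, hall] with t ht1 ht2
        obtain ⟨Pm, hPm, hmax⟩ := hK.exists_isMaxOn hCne.closure
          (f := fun P : X → ℝ => ∑ x, P x * (dA α (W x) (Qp t)).toReal)
          (Continuous.continuousOn (by fun_prop))
        refine ⟨Pm, hPm, ?_⟩
        have h := hQCmin (Qp t) ht1
        have h' : (⨆ P ∈ C, cDiv α W (Qp t) P) ≤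
            ((∑ x, Pm x * (dA α (W x) (Qp t)).toReal : ℝ) : EReal) := by
          refine iSup₂_le fun P hP => ?_
          rw [cDiv_real α W (Qp t) P fun x hx => ht2 x ⟨P, hP, hx⟩]
          exact EReal.coe_le_coe_iff.2 (hmax (subset_closure hP))
        have h'' := h.trans h'
        rw [← hFr] at h''
        exact EReal.coe_le_coe_iff.1 h'')
  refine ⟨P, hP, ⟨hcl0 P hP, hcl1 P hP⟩, ?_, ?_, h2, h3⟩
  · intro x hx
    by_contra h
    exact hx (hclA P hP x h)
  · rw [← hFr]
    exact EReal.coe_le_coe_iff.2 h1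

/-! ### Rényi case -/

lemma dA_renyi_toReal {Y : Type*} [Fintype Y] {α : ℝ} (hα : α ≠ 1) (W Q : Y → ℝ) :
    (dA α W Q).toReal = (1 / (α - 1)) * Real.log (rSum α W Q) := by
  unfold dA rDiv
  rw [if_neg hα]
  split_ifs with h
  · simp [h]
  · exact EReal.toReal_coe _

lemma dA_renyi_ne_top {Y : Type*} [Fintype Y] {α : ℝ} (hα : α ≠ 1) (W Q : Y → ℝ) :
    dA α W Q ≠ ⊤ ↔ rSum α W Q ≠ 0 := by
  unfold dA rDiv
  rw [if_neg hα]
  split_ifs with h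
  · simp [h]
  · simp only [ne_eq, h, not_false_eq_true, iff_true]
    exact EReal.coe_ne_top _

lemma rSum_nonneg {Y : Type*} [Fintype Y] {α : ℝ} {W Q : Y → ℝ} (hW : ∀ y, 0 ≤ W y)
    (hQ : ∀ y, 0 ≤ Q y) : 0 ≤ rSum α W Q :=
  Finset.sum_nonneg fun y _ => mul_nonneg (Real.rpow_nonneg (hW y) _) (Real.rpow_nonneg (hQ y) _)

/-- The vanishing order `t ^ (1/(1-α))` path. -/
noncomputable def rPath {Y : Type*} [Fintype Y] (α : ℝ) (QC R : Y → ℝ) (κ : ℝ) (t : ℝ) (y : Y) : ℝ :=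
  (1 - (∑ z, if QC z = 0 then (1:ℝ) else 0) * (κ * t) ^ (1 / (1 - α))) *
    (QC y + t * (R y - QC y)) + if QC y = 0 then (κ * t) ^ (1 / (1 - α)) else 0

lemma hasDerivAt_s {α : ℝ} (h0 : 0 < α) (h1 : α < 1) (κ : ℝ) :
    HasDerivAt (fun t : ℝ => (κ * t) ^ (1 / (1 - α))) 0 0 := by
  have hp : 1 < 1 / (1 - α) := by
    rw [lt_div_iff₀ (by linarith)]; linarith
  have h := ((hasDerivAt_id (0:ℝ)).const_mul κ).rpow_const (p := 1 / (1 - α)) (Or.inr hp.le)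
  have e : κ * 1 * (1 / (1 - α)) * (κ * id (0:ℝ)) ^ (1 / (1 - α) - 1) = 0 := by
    simp only [id, mul_zero]
    rw [Real.zero_rpow (by linarith), mul_zero]
  rw [e] at h
  exact h

lemma rPath_zero {Y : Type*} [Fintype Y] {α : ℝ} (h1 : α < 1) (QC R : Y → ℝ) (κ : ℝ) :
    rPath α QC R κ 0 = QC := by
  funext y
  have : (1 / (1 - α)) ≠ 0 := by
    have : 0 < 1 / (1 - α) := by apply one_div_pos.2; linarith
    exact this.ne'
  simp only [rPath, mul_zero, Real.zero_rpow this]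
  simp

lemma rPath_pmf {Y : Type*} [Fintype Y] {α : ℝ} (h0 : 0 < α) (h1 : α < 1) (QC R : Y → ℝ)
    (hQC : IsPMF QC) (hR : IsPMF R) (κ : ℝ) (hκ : 0 ≤ κ) :
    ∀ᶠ t in 𝓝[>] (0:ℝ), IsPMF (rPath α QC R κ t) := by
  set m : ℝ := ∑ z, if QC z = 0 then (1:ℝ) else 0 with hm
  have hp : 0 < 1 / (1 - α) := by apply one_div_pos.2; linarith
  have hc : Tendsto (fun t : ℝ => m * (κ * t) ^ (1 / (1 - α))) (𝓝[>] 0) (𝓝 0) := by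
    have := ((hasDerivAt_s h0 h1 κ).continuousAt.tendsto.const_mul m).mono_left
      (nhdsWithin_le_nhds (s := Set.Ioi (0:ℝ)))
    rw [mul_zero, Real.zero_rpow hp.ne', mul_zero] at this
    exact this
  filter_upwards [hc.eventually (ge_mem_nhds (zero_lt_one (α := ℝ))),
    Ioc_mem_nhdsGT (zero_lt_one (α := ℝ))] with t ht1 ht
  have hs : 0 ≤ (κ * t) ^ (1 / (1 - α)) := Real.rpow_nonneg (mul_nonneg hκ ht.1.le) _
  constructor
  · intro y
    unfold rPath
    rw [← hm]
    refine add_nonneg (mul_nonneg (by linarith) ?_) (by split_ifs <;> first | exact hs | exact le_rfl)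
    have a1 := hQC.1 y
    have a2 := hR.1 y
    have : QC y + t * (R y - QC y) = (1 - t) * QC y + t * R y := by ring
    rw [this]
    exact add_nonneg (mul_nonneg (by linarith [ht.2]) a1) (mul_nonneg ht.1.le a2)
  · unfold rPath
    rw [← hm, Finset.sum_add_distrib, ← Finset.mul_sum, Finset.sum_add_distrib, ← Finset.mul_sum,
      Finset.sum_sub_distrib, hQC.2, hR.2]
    have : ∑ y, (if QC y = 0 then (κ * t) ^ (1 / (1 - α)) else 0) =
        m * (κ * t) ^ (1 / (1 - α)) := by
      rw [hm, Finset.sum_mul]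
      refine Finset.sum_congr rfl fun y _ => ?_
      split_ifs <;> simp
    rw [this]; ring

lemma rPath_deriv {Y : Type*} [Fintype Y] {α : ℝ} (h0 : 0 < α) (h1 : α < 1) (QC R : Y → ℝ)
    (hQC : IsPMF QC) (hR0 : ∀ y, QC y = 0 → R y = 0) (κ : ℝ) (hκ : 0 ≤ κ) (w : Y → ℝ) :
    HasDerivWithinAt (fun t => rSum α w (rPath α QC R κ t))
      ((1 - α) * (∑ y, w y ^ α * QC y ^ (1 - α) * R y / QC y - rSum α w QC) +
        κ * ∑ y, if QC y = 0 then w y ^ α else 0) (Set.Ioi 0) 0 := by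
  unfold rSum
  have e : (1 - α) * (∑ y, w y ^ α * QC y ^ (1 - α) * R y / QC y -
      ∑ y, w y ^ α * QC y ^ (1 - α)) + κ * ∑ y, (if QC y = 0 then w y ^ α else 0) =
      ∑ y, ((1 - α) * (w y ^ α * QC y ^ (1 - α) * R y / QC y - w y ^ α * QC y ^ (1 - α)) +
        κ * (if QC y = 0 then w y ^ α else 0)) := by
    rw [Finset.sum_add_distrib, ← Finset.mul_sum, ← Finset.mul_sum, Finset.sum_sub_distrib]
  rw [e]
  refine HasDerivWithinAt.fun_sum fun y _ => ?_
  have hα : 1 - α ≠ 0 := by linarith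
  have hp : 0 < 1 / (1 - α) := by apply one_div_pos.2; linarith
  by_cases hy : QC y = 0
  · have h : HasDerivWithinAt (fun t : ℝ => w y ^ α * (κ * t)) (w y ^ α * (κ * 1)) (Set.Ioi 0) 0 :=
      (((hasDerivAt_id (0:ℝ)).const_mul κ).const_mul (w y ^ α)).hasDerivWithinAt
    have h2 : ∀ t : ℝ, 0 ≤ t → w y ^ α * rPath α QC R κ t y ^ (1 - α) = w y ^ α * (κ * t) := by
      intro t ht
      have : rPath α QC R κ t y = (κ * t) ^ (1 / (1 - α)) := by
        simp [rPath, hy, hR0 y hy]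
      rw [this, ← Real.rpow_mul (mul_nonneg hκ ht), one_div_mul_cancel hα, Real.rpow_one]
    refine (h.congr (fun t ht => h2 t (le_of_lt ht)) (h2 0 le_rfl)).congr_deriv ?_
    simp [hy, hα]; ring
  · have hs := hasDerivAt_s h0 h1 κ
    have hq : HasDerivAt (fun t : ℝ => rPath α QC R κ t y) (R y - QC y) 0 := by
      simp only [rPath, if_neg hy]
      have := ((hs.const_mul (∑ z, if QC z = 0 then (1:ℝ) else 0)).const_sub 1).mul
        (((hasDerivAt_id (0:ℝ)).mul_const (R y - QC y)).const_add (QC y))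
      refine (this.add_const 0).congr_deriv ?_
      rw [mul_zero κ, Real.zero_rpow hp.ne']
      simp
    have hq0 : rPath α QC R κ 0 y = QC y := by rw [rPath_zero h1]
    have := (hq.rpow_const (p := 1 - α) (Or.inl (by rw [hq0]; exact hy))).const_mul (w y ^ α)
    refine this.hasDerivWithinAt.congr_deriv ?_
    have hpos : 0 < QC y := lt_of_le_of_ne (hQC.1 y) (Ne.symm hy)
    rw [hq0, Real.rpow_sub_one hy]
    simp only [hy, if_false]
    field_simp
    ring

theorem renyi_case {X Y : Type*} [Fintype X] [Fintype Y]
    (α : ℝ) (h0 : 0 < α) (h1 : α < 1)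
    (W : X → Y → ℝ) (hW : ∀ x, IsPMF (W x))
    (C : Set (X → ℝ)) (hCne : C.Nonempty) (hCpmf : ∀ P ∈ C, IsPMF P)
    (hCconv : Convex ℝ C)
    (QC : Y → ℝ) (hQC : IsPMF QC)
    (hQCmin : ∀ Q : Y → ℝ, IsPMF Q →
      (⨆ P ∈ C, cDiv α W QC P) ≤ ⨆ P ∈ C, cDiv α W Q P)
    (hfin : (⨆ P ∈ C, cDiv α W QC P) ≠ ⊤)
    (Q : Y → ℝ) (hQ : IsPMF Q) (hQfin : (⨆ P ∈ C, cDiv α W Q P) ≠ ⊤) :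
    ∃ P ∈ closure C,
      (⨆ P ∈ C, cDiv α W QC P) ≤ ((∑ x, P x * (dA α (W x) QC).toReal : ℝ) : EReal) ∧
      dA α QC Q ≤ ((∑ x, P x * (dA α (W x) Q).toReal -
        ∑ x, P x * (dA α (W x) QC).toReal : ℝ) : EReal) := by
  have hα : α ≠ 1 := h1.ne
  have hS : ∀ x, (∃ P ∈ C, P x ≠ 0) → 0 < rSum α (W x) QC := fun x hx =>
    lt_of_le_of_ne (rSum_nonneg (hW x).1 hQC.1)
      (Ne.symm ((dA_renyi_ne_top hα _ _).1 (dA_fin_of_sup α W C hCpmf QC hfin x hx)))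
  have hSQ : ∀ x, (∃ P ∈ C, P x ≠ 0) → 0 < rSum α (W x) Q := fun x hx =>
    lt_of_le_of_ne (rSum_nonneg (hW x).1 hQ.1)
      (Ne.symm ((dA_renyi_ne_top hα _ _).1 (dA_fin_of_sup α W C hCpmf Q hQfin x hx)))
  have hα' : 1 - α ≠ 0 := by linarith
  have hα'' : α - 1 ≠ 0 := by linarith
  have hb0 : ∀ x y, 0 ≤ if QC y = 0 then W x y ^ α else 0 := by
    intro x y
    split_ifs
    · exact Real.rpow_nonneg ((hW x).1 y) _
    · exact le_rfl
  have hβ : ∀ x, (∃ P ∈ C, P x ≠ 0) →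
      0 ≤ (∑ y, if QC y = 0 then W x y ^ α else 0) / ((1 - α) * rSum α (W x) QC) := by
    intro x hx
    exact div_nonneg (Finset.sum_nonneg fun y _ => hb0 x y)
      (mul_nonneg (by linarith) (hS x hx).le)
  obtain ⟨P, hPc, hP, hPA, hPV, hPT, hPβ⟩ := bridge α W C hCne hCpmf hCconv QC hQC hQCmin hfin
    (fun x y => W x y ^ α * QC y ^ (1 - α) / rSum α (W x) QC)
    (fun x => (∑ y, if QC y = 0 then W x y ^ α else 0) / ((1 - α) * rSum α (W x) QC))
    (by
      intro x hx
      refine ⟨fun y => ?_, ?_⟩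
      · exact div_nonneg (mul_nonneg (Real.rpow_nonneg ((hW x).1 y) _)
          (Real.rpow_nonneg (hQC.1 y) _)) (hS x hx).le
      · rw [← Finset.sum_div]
        exact div_self (hS x hx).ne')
    (by
      intro x _ y hy
      simp [hy, Real.zero_rpow hα'])
    hβ
    (by
      intro R hR hR0 κ hκ
      refine ⟨rPath α QC R κ, rPath_zero h1 QC R κ, rPath_pmf h0 h1 QC R hQC hR κ hκ, ?_⟩
      intro x hx
      have hd := rPath_deriv h0 h1 QC R hQC hR0 κ hκ (W x)
      have hv : rSum α (W x) (rPath α QC R κ 0) = rSum α (W x) QC := by rw [rPath_zero h1]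
      constructor
      · have := hd.continuousWithinAt.tendsto.eventually_ne
          (by rw [hv]; exact (hS x hx).ne' : _ ≠ (0:ℝ))
        filter_upwards [this] with t ht
        exact (dA_renyi_ne_top hα _ _).2 ht
      · simp only [dA_renyi_toReal hα]
        refine ((hd.log (by rw [hv]; exact (hS x hx).ne')).const_mul (1 / (α - 1))).congr_deriv ?_
        rw [hv]
        have hSx := (hS x hx).ne'
        have e : ∑ y, W x y ^ α * QC y ^ (1 - α) / rSum α (W x) QC * R y / QC y =
            (∑ y, W x y ^ α * QC y ^ (1 - α) * R y / QC y) / rSum α (W x) QC := by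
          rw [Finset.sum_div]
          refine Finset.sum_congr rfl fun y _ => ?_
          ring
        rw [e]
        have : α - 1 = -(1 - α) := by ring
        rw [this]
        field_simp
        ring)
  refine ⟨P, hPc, hPV, ?_⟩
  have hWQ : ∀ x, P x ≠ 0 → ∀ y, QC y = 0 → W x y ^ α = 0 := by
    intro x hx y hy
    have hnn : ∀ x ∈ Finset.univ, 0 ≤ P x *
        ((∑ y, if QC y = 0 then W x y ^ α else 0) / ((1 - α) * rSum α (W x) QC)) := by
      intro x _
      by_cases hx : P x = 0
      · simp [hx]
      · exact mul_nonneg (hP.1 x) (hβ x (hPA x hx))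
    have h := (Finset.sum_eq_zero_iff_of_nonneg hnn).1 hPβ x (Finset.mem_univ x)
    have hSx := (hS x (hPA x hx)).ne'
    have h' : ∑ y, (if QC y = 0 then W x y ^ α else 0) = 0 := by
      rcases mul_eq_zero.1 h with h | h
      · exact absurd h hx
      · rcases div_eq_zero_iff.1 h with h | h
        · exact h
        · exact absurd h (mul_ne_zero hα' hSx)
    have h'' := (Finset.sum_eq_zero_iff_of_nonneg (fun y _ => hb0 x y)).1 h' y (Finset.mem_univ y)
    simpa [hy] using h''
  have hM : rSum α QC Q = ∑ x, P x * (rSum α (W x) Q / rSum α (W x) QC) := by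
    have e : ∀ x, P x * (rSum α (W x) Q / rSum α (W x) QC) =
        ∑ y, P x * (W x y ^ α * Q y ^ (1 - α)) / rSum α (W x) QC := by
      intro x
      rw [← Finset.sum_div, ← Finset.mul_sum, mul_div_assoc]
      rfl
    simp_rw [e]
    rw [Finset.sum_comm]
    unfold rSum
    refine Finset.sum_congr rfl fun y _ => ?_
    change _ = ∑ x, P x * (W x y ^ α * Q y ^ (1 - α)) / rSum α (W x) QC
    by_cases hy : QC y = 0
    · rw [hy, Real.zero_rpow h0.ne', zero_mul]
      refine (Finset.sum_eq_zero fun x _ => ?_).symm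
      by_cases hx : P x = 0
      · simp [hx]
      · simp [hWQ x hx y hy]
    · have hpos : 0 < QC y := lt_of_le_of_ne (hQC.1 y) (Ne.symm hy)
      have hpw : QC y ^ (1 - α) ≠ 0 := (Real.rpow_pos_of_pos hpos _).ne'
      have e1 : QC y ^ α = QC y / QC y ^ (1 - α) := by
        rw [eq_div_iff hpw, ← Real.rpow_add hpos]
        simp
      rw [e1]
      nth_rewrite 1 [← hPT y]
      rw [Finset.sum_div, Finset.sum_mul]
      refine Finset.sum_congr rfl fun x _ => ?_
      field_simp
  have hZ : ∀ x, P x ≠ 0 → 0 < rSum α (W x) Q / rSum α (W x) QC := fun x hx =>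
    div_pos (hSQ x (hPA x hx)) (hS x (hPA x hx))
  have hMpos : 0 < rSum α QC Q := by
    rw [hM]
    have hex : ∃ x, P x ≠ 0 := by
      by_contra! h
      have := hP.2
      simp [h] at this
    obtain ⟨x, hx⟩ := hex
    refine Finset.sum_pos' (fun z _ => ?_) ⟨x, Finset.mem_univ x, ?_⟩
    · by_cases hz : P z = 0
      · simp [hz]
      · exact mul_nonneg (hP.1 z) (hZ z hz).le
    · exact mul_pos (lt_of_le_of_ne (hP.1 x) (Ne.symm hx)) (hZ x hx)
  have hlog : ∑ x, P x * (Real.log (rSum α (W x) Q) - Real.log (rSum α (W x) QC)) ≤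
      Real.log (rSum α QC Q) := by
    set M := rSum α QC Q with hMdef
    have : ∀ x ∈ Finset.univ, P x * (Real.log (rSum α (W x) Q) - Real.log (rSum α (W x) QC)) ≤
        P x * (Real.log M - 1) + P x * (rSum α (W x) Q / rSum α (W x) QC) / M := by
      intro x _
      by_cases hx : P x = 0
      · simp [hx]
      · have hz := hZ x hx
        have hl := Real.log_le_sub_one_of_pos (div_pos hz hMpos)
        rw [Real.log_div hz.ne' hMpos.ne', Real.log_div (hSQ x (hPA x hx)).ne'
          (hS x (hPA x hx)).ne'] at hl
        rw [mul_div_assoc, ← mul_add]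
        refine mul_le_mul_of_nonneg_left ?_ (hP.1 x)
        linarith
    refine (Finset.sum_le_sum this).trans ?_
    rw [Finset.sum_add_distrib, ← Finset.sum_mul, ← Finset.sum_div, ← hM, hP.2,
      div_self hMpos.ne']
    linarith
  have hne : dA α QC Q ≠ ⊤ := (dA_renyi_ne_top hα _ _).2 hMpos.ne'
  rw [← EReal.coe_toReal hne (dA_ne_bot _ _ _), EReal.coe_le_coe_iff]
  simp only [dA_renyi_toReal hα]
  rw [← Finset.sum_sub_distrib]
  have e : ∑ x, (P x * (1 / (α - 1) * Real.log (rSum α (W x) Q)) -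
      P x * (1 / (α - 1) * Real.log (rSum α (W x) QC))) =
      (1 / (α - 1)) * ∑ x, P x * (Real.log (rSum α (W x) Q) - Real.log (rSum α (W x) QC)) := by
    rw [Finset.mul_sum]
    refine Finset.sum_congr rfl fun x _ => ?_
    ring
  rw [e]
  exact mul_le_mul_of_nonpos_left hlog (one_div_nonpos.2 (by linarith))

/-! ### Kullback–Leibler case -/

lemma dA_kl_ne_top {Y : Type*} [Fintype Y] (W Q : Y → ℝ) :
    dA 1 W Q ≠ ⊤ ↔ ∀ y, Q y = 0 → W y = 0 := by
  unfold dA kDiv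
  rw [if_pos rfl]
  split_ifs with h
  · exact iff_of_true (EReal.coe_ne_top _) h
  · simp only [ne_eq, not_true_eq_false, false_iff]
    exact h

lemma dA_kl_toReal {Y : Type*} [Fintype Y] (W Q : Y → ℝ) (h : ∀ y, Q y = 0 → W y = 0) :
    (dA 1 W Q).toReal = ∑ y, W y * (Real.log (W y) - Real.log (Q y)) := by
  unfold dA kDiv
  rw [if_pos rfl, if_pos h, EReal.toReal_coe]
  refine Finset.sum_congr rfl fun y _ => ?_
  split_ifs with hy
  · simp [hy]
  · rw [Real.log_div hy (fun hq => hy (h y hq))]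

theorem kl_case {X Y : Type*} [Fintype X] [Fintype Y]
    (W : X → Y → ℝ) (hW : ∀ x, IsPMF (W x))
    (C : Set (X → ℝ)) (hCne : C.Nonempty) (hCpmf : ∀ P ∈ C, IsPMF P)
    (hCconv : Convex ℝ C)
    (QC : Y → ℝ) (hQC : IsPMF QC)
    (hQCmin : ∀ Q : Y → ℝ, IsPMF Q →
      (⨆ P ∈ C, cDiv 1 W QC P) ≤ ⨆ P ∈ C, cDiv 1 W Q P)
    (hfin : (⨆ P ∈ C, cDiv 1 W QC P) ≠ ⊤)
    (Q : Y → ℝ) (hQfin : (⨆ P ∈ C, cDiv 1 W Q P) ≠ ⊤) :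
    ∃ P ∈ closure C,
      (⨆ P ∈ C, cDiv 1 W QC P) ≤ ((∑ x, P x * (dA 1 (W x) QC).toReal : ℝ) : EReal) ∧
      dA 1 QC Q ≤ ((∑ x, P x * (dA 1 (W x) Q).toReal -
        ∑ x, P x * (dA 1 (W x) QC).toReal : ℝ) : EReal) := by
  have hS : ∀ x, (∃ P ∈ C, P x ≠ 0) → ∀ y, QC y = 0 → W x y = 0 := fun x hx =>
    (dA_kl_ne_top _ _).1 (dA_fin_of_sup 1 W C hCpmf QC hfin x hx)
  have hSQ : ∀ x, (∃ P ∈ C, P x ≠ 0) → ∀ y, Q y = 0 → W x y = 0 := fun x hx =>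
    (dA_kl_ne_top _ _).1 (dA_fin_of_sup 1 W C hCpmf Q hQfin x hx)
  obtain ⟨P, hPc, hP, hPA, hPV, hPT, -⟩ := bridge 1 W C hCne hCpmf hCconv QC hQC hQCmin hfin
    W (fun _ => 0) (fun x _ => hW x) hS (fun _ _ => le_rfl)
    (by
      intro R hR hR0 κ hκ
      have hz : ∀ t ∈ Set.Ioo (0:ℝ) 1, ∀ y, QC y + t * (R y - QC y) = 0 → QC y = 0 := by
        intro t ht y h
        have a1 := hQC.1 y
        have a2 := mul_nonneg ht.1.le (hR.1 y)
        have a3 : (1 - t) * QC y + t * R y = 0 := by linarith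
        have a4 : 0 ≤ (1 - t) * QC y := mul_nonneg (by linarith [ht.2]) a1
        have a5 : (1 - t) * QC y = 0 := by linarith
        rcases mul_eq_zero.1 a5 with h | h
        · linarith [ht.2]
        · exact h
      refine ⟨fun t y => QC y + t * (R y - QC y), by simp, ?_, ?_⟩
      · filter_upwards [Ioo_mem_nhdsGT (zero_lt_one (α := ℝ))] with t ht
        refine ⟨fun y => ?_, ?_⟩
        · have : QC y + t * (R y - QC y) = (1 - t) * QC y + t * R y := by ring
          change 0 ≤ QC y + t * (R y - QC y)
          rw [this]
          exact add_nonneg (mul_nonneg (by linarith [ht.2]) (hQC.1 y))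
            (mul_nonneg ht.1.le (hR.1 y))
        · rw [Finset.sum_add_distrib, ← Finset.mul_sum, Finset.sum_sub_distrib, hQC.2, hR.2]
          ring
      · intro x hx
        constructor
        · filter_upwards [Ioo_mem_nhdsGT (zero_lt_one (α := ℝ))] with t ht
          exact (dA_kl_ne_top _ _).2 fun y hy => hS x hx y (hz t ht y hy)
        · have hd : HasDerivWithinAt (fun t : ℝ => ∑ y, W x y *
              (Real.log (W x y) - Real.log (QC y + t * (R y - QC y))))
              (∑ y, (W x y - W x y * R y / QC y)) (Set.Ioi 0) 0 := by
            refine HasDerivWithinAt.fun_sum fun y _ => ?_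
            by_cases hy : QC y = 0
            · simp only [hS x hx y hy, zero_mul, zero_div, sub_zero]
              exact hasDerivWithinAt_const _ _ _
            · have h1 : HasDerivAt (fun t : ℝ => QC y + t * (R y - QC y)) (1 * (R y - QC y)) 0 :=
                ((hasDerivAt_id (0:ℝ)).mul_const (R y - QC y)).const_add (QC y)
              have h2 := ((h1.log (by simpa using hy)).const_sub (Real.log (W x y))).const_mul
                (W x y)
              refine h2.hasDerivWithinAt.congr_deriv ?_
              simp only [zero_mul, add_zero]
              field_simp
              ring
          have hd' := hd.congr_of_eventuallyEq
            (f₁ := fun t : ℝ => (dA 1 (W x) (fun y => QC y + t * (R y - QC y))).toReal)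
            (by
              filter_upwards [Ioo_mem_nhdsGT (zero_lt_one (α := ℝ))] with t ht
              exact dA_kl_toReal _ _ fun y hy => hS x hx y (hz t ht y hy))
            (dA_kl_toReal _ _ fun y hy => hS x hx y (by simpa using hy))
          refine hd'.congr_deriv ?_
          rw [Finset.sum_sub_distrib, (hW x).2]
          ring)
  refine ⟨P, hPc, hPV, ?_⟩
  have hQCQ : ∀ y, Q y = 0 → QC y = 0 := by
    intro y hy
    rw [← hPT y]
    refine Finset.sum_eq_zero fun x _ => ?_
    by_cases hx : P x = 0
    · simp [hx]
    · simp [hSQ x (hPA x hx) y hy]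
  rw [← EReal.coe_toReal ((dA_kl_ne_top _ _).2 hQCQ) (dA_ne_bot _ _ _), EReal.coe_le_coe_iff,
    dA_kl_toReal _ _ hQCQ, ← Finset.sum_sub_distrib]
  have e : ∀ x, P x * (dA 1 (W x) Q).toReal - P x * (dA 1 (W x) QC).toReal =
      ∑ y, P x * W x y * (Real.log (QC y) - Real.log (Q y)) := by
    intro x
    by_cases hx : P x = 0
    · simp [hx]
    · rw [dA_kl_toReal _ _ (hSQ x (hPA x hx)), dA_kl_toReal _ _ (hS x (hPA x hx)), ← mul_sub,
        ← Finset.sum_sub_distrib, Finset.mul_sum]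
      refine Finset.sum_congr rfl fun y _ => ?_
      ring
  simp_rw [e]
  rw [Finset.sum_comm]
  refine le_of_eq (Finset.sum_congr rfl fun y _ => ?_)
  rw [← Finset.sum_mul, hPT y]

/-- the Erven–Harremoës bound for the Augustin capacity. -/
theorem augustin_capacity_EH_bound {X Y : Type*} [Fintype X] [Fintype Y]
    [Nonempty X] [Nonempty Y]
    (α : ℝ) (hα : α ∈ Set.Ioc (0 : ℝ) 1)
    (W : X → Y → ℝ) (hW : ∀ x, IsPMF (W x))
    (C : Set (X → ℝ)) (hCne : C.Nonempty) (hCpmf : ∀ P ∈ C, IsPMF P)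
    (hCconv : Convex ℝ C)
    (hfin : (⨆ P ∈ C, aInfo α P W) ≠ ⊤)
    (QC : Y → ℝ) (hQC : IsPMF QC)
    (hQCmin : ∀ Q : Y → ℝ, IsPMF Q →
      (⨆ P ∈ C, cDiv α W QC P) ≤ ⨆ P ∈ C, cDiv α W Q P) :
    ∀ Q : Y → ℝ, IsPMF Q →
      (⨆ P ∈ C, cDiv α W Q P) ≥ (⨆ P ∈ C, aInfo α P W) + dA α QC Q := by
  intro Q hQ
  by_cases hQfin : (⨆ P ∈ C, cDiv α W Q P) = ⊤
  · rw [hQfin]; exact le_top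
  have hCfin : (⨆ P ∈ C, cDiv α W QC P) ≠ ⊤ := fun h =>
    hQfin (top_le_iff.1 (h ▸ hQCmin Q hQ))
  have key : ∃ P ∈ closure C,
      (⨆ P ∈ C, cDiv α W QC P) ≤ ((∑ x, P x * (dA α (W x) QC).toReal : ℝ) : EReal) ∧
      dA α QC Q ≤ ((∑ x, P x * (dA α (W x) Q).toReal -
        ∑ x, P x * (dA α (W x) QC).toReal : ℝ) : EReal) := by
    rcases hα.2.lt_or_eq with h | h
    · exact renyi_case α hα.1 h W hW C hCne hCpmf hCconv QC hQC hQCmin hCfin Q hQ hQfin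
    · subst h
      exact kl_case W hW C hCne hCpmf hCconv QC hQC hQCmin hCfin Q hQfin
  obtain ⟨P, hPc, h1, h2⟩ := key
  have h3 : (⨆ P ∈ C, aInfo α P W) ≤ ⨆ P ∈ C, cDiv α W QC P :=
    iSup₂_mono fun P _ => iInf₂_le (f := fun Q (_ : Q ∈ {Q : Y → ℝ | IsPMF Q}) => cDiv α W Q P)
      QC hQC
  refine ge_iff_le.2 (((add_le_add (h3.trans h1) h2).trans ?_).trans
    (le_sup_closure α W C hCpmf hCne Q hQfin P hPc))
  rw [← EReal.coe_add]
  exact EReal.coe_le_coe_iff.2 (by linarith)
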